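/- Assume |Ψ_A| ≤ R and |Ψ_W| ≤ R everywhere. Fix μ_x ∈ P₂(ℝ^{d_x}) and M_z > 0, and assume Stage-I well-specifiedness at μ_x: there exists μ_z° ∈ P₂(ℝ^{d_z}) with KL(μ_z°, ν_z) ≤ M_z such that for every bounded measurable u : ℝ^{d_w} → ℝ, ∫(∫Ψ_A(a, x) dμ_x(x))·u(w) dP_{AW}(a, w) = ∫(∫Ψ_W(w, z) dμ_z°(z))·u(w) dP_W(w) (i.e. w ↦ ∫Ψ_W(w, z) dμ_z°(z) is a version of the conditional expectation of ∫Ψ_A(A, x) dμ_x(x) given W). Let δ ∈ (0, 1/2) and m ≥ 1, and let (A_i, W_i)_{i=1,…,m} be i.i.d. with law P_{AW}. Let μ̂_z be a random element of P₂(ℝ^{d_z}) that almost surely minimizes, with finite value, ν ↦ (1/(2m))·Σ_{i=1}^m (∫Ψ_W(W_i, z) dν(z) − ∫Ψ_A(A_i, x) dμ_x(x))² + (ζ₁/2)∫‖z‖² dν + σ₁·Ent(ν) over P₂(ℝ^{d_z}), with ω ↦ ∫(∫Ψ_W(w, z) dμ̂_z(z) − ∫Ψ_W(w, z) dμ_z°(z))²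 dP_W(w) measurable. Then there exists an absolute constant C > 0 such that, with probability at least 1 − 2δ, ∫(∫Ψ_W(w, z) dμ̂_z(z) − ∫Ψ_W(w, z) dμ_z°(z))² dP_W(w) ≤ C·(σ₁M_z + R²√(log(1/δ)/m) + R²√((M_z + R²/σ₁)/m)). -/

import Mathlib

open MeasureTheory ProbabilityTheory Real Filter
open scoped ENNReal Classical

noncomputable section

/-- `Euc d` is Euclidean space `ℝ^d`. -/
abbrev Euc (d : ℕ) : Type := EuclideanSpace ℝ (Fin d)

/-- `P₂(ℝ^d)`: Borel probability measures with finite second moment. -/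
def IsP2 {d : ℕ} (μ : Measure (Euc d)) : Prop :=
  IsProbabilityMeasure μ ∧ Integrable (fun x => ‖x‖ ^ 2) μ

/-- Negative entropy of a probability measure, valued in `ℝ ∪ {+∞}` (as `EReal`). -/
def Ent {d : ℕ} (μ : Measure (Euc d)) : EReal :=
  if μ ≪ (volume : Measure (Euc d)) ∧
      Integrable (fun x => Real.log (μ.rnDeriv volume x).toReal) μ then
    ((∫ x, Real.log (μ.rnDeriv volume x).toReal ∂μ : ℝ) : EReal)
  else ⊤

/-- Kullback–Leibler divergence `KL(ν, μ)`, valued in `ℝ ∪ {+∞}` (as `EReal`). -/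
def KL {α : Type*} [MeasurableSpace α] (ν μ : Measure α) : EReal :=
  if ν ≪ μ ∧ Integrable (fun x => Real.log (ν.rnDeriv μ x).toReal) ν then
    ((∫ x, Real.log (ν.rnDeriv μ x).toReal ∂ν : ℝ) : EReal)
  else ⊤

/-- The centered Gaussian probability measure on `ℝ^d` with density proportional to
`exp(−c‖x‖²)`. -/
def gaussLike (d : ℕ) (c : ℝ) : Measure (Euc d) :=
  (volume : Measure (Euc d)).withDensity fun x =>
    ENNReal.ofReal (Real.exp (-(c * ‖x‖ ^ 2)) / ∫ y : Euc d, Real.exp (-(c * ‖y‖ ^ 2)))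

/-- The empirical Stage-I objective
`ν ↦ (1/(2m))Σᵢ(∫Ψ_W(Wᵢ,z)dν − ∫Ψ_A(Aᵢ,x)dμ_x)² + (ζ₁/2)∫‖z‖²dν + σ₁ Ent(ν)`. -/
def stage1Emp {da dw dx dz : ℕ} {Ω : Type} (ΨA : Euc da → Euc dx → ℝ)
    (ΨW : Euc dw → Euc dz → ℝ) (ζ1 σ1 : ℝ) (m : ℕ)
    (Av : Fin m → Ω → Euc da) (Wv : Fin m → Ω → Euc dw)
    (μx : Measure (Euc dx)) (ω : Ω) (ν : Measure (Euc dz)) : EReal :=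
  (((1 / (2 * (m : ℝ))) *
      ∑ i : Fin m, ((∫ z, ΨW (Wv i ω) z ∂ν) - (∫ x, ΨA (Av i ω) x ∂μx)) ^ 2 +
    (ζ1 / 2) * ∫ z, ‖z‖ ^ 2 ∂ν : ℝ) : EReal) + (σ1 : EReal) * Ent ν

lemma integral_le_integral_llr_add_log_integral_exp {α : Type*} [MeasurableSpace α]
    {ν ρ : Measure α} [IsProbabilityMeasure ν] [IsProbabilityMeasure ρ] (hac : ν ≪ ρ)
    (hllr : Integrable (llr ν ρ) ν) {f : α → ℝ} (hf : Measurable f) {c : ℝ}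
    (hc : ∀ x, |f x| ≤ c) :
    ∫ x, f x ∂ν ≤ ∫ x, llr ν ρ x ∂ν + Real.log (∫ x, Real.exp (f x) ∂ρ) := by
  have hfν : Integrable f ν := .of_bound hf.aestronglyMeasurable c (ae_of_all _ hc)
  have hexp : Integrable (fun x => Real.exp (f x)) ρ :=
    .of_bound (by fun_prop) (Real.exp c)
      (ae_of_all _ fun x => by
        rw [Real.norm_eq_abs, Real.abs_exp]
        exact Real.exp_le_exp.2 ((le_abs_self _).trans (hc x)))
  have := isProbabilityMeasure_tilted hexp
  have h := InformationTheory.integral_llr_add_sub_measure_univ_nonneg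
    (hac.trans (absolutelyContinuous_tilted hexp))
    (integrable_llr_tilted_right hac hfν hllr hexp)
  rw [integral_llr_tilted_right hac hfν hexp hllr] at h
  simp at h
  linarith

lemma integral_prod_le_integral_llr_add_log_integral_exp {α : Type*} [MeasurableSpace α]
    {ν ρ : Measure α} [IsProbabilityMeasure ν] [IsProbabilityMeasure ρ] (hac : ν ≪ ρ)
    (hllr : Integrable (llr ν ρ) ν) {f : α × α → ℝ} (hf : Measurable f) {c : ℝ}
    (hc : ∀ x, |f x| ≤ c) :
    ∫ p, f p ∂(ν.prod ν) ≤
      2 * ∫ x, llr ν ρ x ∂ν + Real.log (∫ p, Real.exp (f p) ∂(ρ.prod ρ)) := by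
  have hexp_le : ∀ p, Real.exp (f p) ≤ Real.exp c := fun p =>
    Real.exp_le_exp.2 ((le_abs_self _).trans (hc p))
  have hle_exp : ∀ p, Real.exp (-c) ≤ Real.exp (f p) := fun p =>
    Real.exp_le_exp.2 (neg_le_of_abs_le (hc p))
  have hexp : Integrable (fun p => Real.exp (f p)) (ρ.prod ρ) :=
    .of_bound (by fun_prop) (Real.exp c)
      (ae_of_all _ fun x => by rw [Real.norm_eq_abs, Real.abs_exp]; exact hexp_le x)
  have hexp_sec : ∀ x, Integrable (fun y => Real.exp (f (x, y))) ρ := fun x =>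
    .of_bound (hf.comp measurable_prodMk_left).exp.aestronglyMeasurable (Real.exp c)
      (ae_of_all _ fun y => by rw [Real.norm_eq_abs, Real.abs_exp]; exact hexp_le _)
  have hfν : Integrable f (ν.prod ν) := .of_bound hf.aestronglyMeasurable c (ae_of_all _ hc)
  have hlow : ∀ x, Real.exp (-c) ≤ ∫ y, Real.exp (f (x, y)) ∂ρ := fun x => by
    simpa using integral_mono (integrable_const (Real.exp (-c))) (hexp_sec x)
      fun y => hle_exp (x, y)
  have hupp : ∀ x, ∫ y, Real.exp (f (x, y)) ∂ρ ≤ Real.exp c := fun x => by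
    simpa using integral_mono (hexp_sec x) (integrable_const (Real.exp c))
      fun y => hexp_le (x, y)
  have hpos : ∀ x, 0 < ∫ y, Real.exp (f (x, y)) ∂ρ := fun x => (Real.exp_pos _).trans_le (hlow x)
  have hm : Measurable fun x => Real.log (∫ y, Real.exp (f (x, y)) ∂ρ) :=
    (hf.exp.stronglyMeasurable.integral_prod_right (ν := ρ)).measurable.log
  have hb : ∀ x, |Real.log (∫ y, Real.exp (f (x, y)) ∂ρ)| ≤ c := fun x =>
    abs_le.2 ⟨(Real.le_log_iff_exp_le (hpos x)).2 (hlow x),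
      (Real.log_le_iff_le_exp (hpos x)).2 (hupp x)⟩
  have h := integral_le_integral_llr_add_log_integral_exp hac hllr hm hb
  simp_rw [Real.exp_log (hpos _)] at h
  rw [integral_prod _ hfν, integral_prod _ hexp]
  have h2 : ∫ x, ∫ y, f (x, y) ∂ν ∂ν ≤
      ∫ x, (∫ y, llr ν ρ y ∂ν + Real.log (∫ y, Real.exp (f (x, y)) ∂ρ)) ∂ν := by
    have hi : Integrable (fun x => Real.log (∫ y, Real.exp (f (x, y)) ∂ρ)) ν :=
      .of_bound hm.aestronglyMeasurable c (ae_of_all _ hb)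
    refine integral_mono hfν.integral_prod_left ((integrable_const _).add hi) fun x => ?_
    exact integral_le_integral_llr_add_log_integral_exp hac hllr
      (hf.comp measurable_prodMk_left) fun y => hc (x, y)
  rw [integral_add (integrable_const _) (.of_bound hm.aestronglyMeasurable c (ae_of_all _ hb))]
    at h2
  simp only [integral_const, probReal_univ, one_smul] at h2
  linarith

lemma integral_exp_mul_sub_average_le {α : Type*} [MeasurableSpace α] {μ : Measure α}
    [IsProbabilityMeasure μ] {g : α → ℝ} (hg : Measurable g) {b : ℝ} (hb : ∀ a, |g a| ≤ b)
    {m : ℕ} (hm : 1 ≤ m) (l : ℝ) :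
    ∫ y : Fin m → α, Real.exp (l * (∫ a, g a ∂μ - (1 / (m : ℝ)) * ∑ i, g (y i)))
      ∂(Measure.pi fun _ => μ) ≤ Real.exp (l ^ 2 * b ^ 2 / (2 * m)) := by
  have hm0 : (0 : ℝ) < m := by exact_mod_cast hm
  have hsub := hasSubgaussianMGF_of_mem_Icc (μ := μ) (X := g) (a := -b) (b := b)
    hg.aemeasurable (ae_of_all _ fun a => abs_le.1 (hb a))
  have hmgf := hsub.mgf_le (-(l / m))
  have heq : ∀ y : Fin m → α,
      Real.exp (l * (∫ a, g a ∂μ - (1 / (m : ℝ)) * ∑ i, g (y i))) =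
        ∏ i, Real.exp (-(l / m) * (g (y i) - ∫ a, g a ∂μ)) := fun y => by
    rw [← Real.exp_sum, ← Finset.mul_sum, Finset.sum_sub_distrib]
    congr 1
    simp
    field_simp
    ring
  simp_rw [heq]
  rw [integral_fintype_prod_eq_pow (fun a => Real.exp (-(l / m) * (g a - ∫ a, g a ∂μ))),
    Fintype.card_fin]
  have hcoe : (((‖b - -b‖₊ / 2) ^ 2 : NNReal) : ℝ) = b ^ 2 := by
    push_cast
    rw [Real.norm_eq_abs, div_pow, sq_abs]
    ring
  rw [hcoe] at hmgf
  calc _ ≤ (Real.exp (b ^ 2 * (-(l / m)) ^ 2 / 2)) ^ m :=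
        pow_le_pow_left₀ (integral_nonneg fun a => (Real.exp_pos _).le) hmgf m
    _ = Real.exp (l ^ 2 * b ^ 2 / (2 * m)) := by
        rw [← Real.exp_nat_mul]
        congr 1
        field_simp

/-- A PAC-Bayes bound for losses depending on two independent draws from the posterior. -/
lemma exists_measurableSet_pacBayes {α Z : Type*} [MeasurableSpace α] [MeasurableSpace Z]
    {μ : Measure α} [IsProbabilityMeasure μ] {ρ : Measure Z} [IsProbabilityMeasure ρ]
    {g : Z × Z → α → ℝ} (hg : Measurable (Function.uncurry g)) {b : ℝ}
    (hb : ∀ p a, |g p a| ≤ b) {m : ℕ} (hm : 1 ≤ m) {l δ : ℝ} (hl : 0 < l) (hδ : 0 < δ) :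
    ∃ S : Set (Fin m → α), MeasurableSet S ∧
      (Measure.pi fun _ => μ) Sᶜ ≤ ENNReal.ofReal δ ∧
      ∀ y ∈ S, ∀ ν : Measure Z, IsProbabilityMeasure ν → ν ≪ ρ → Integrable (llr ν ρ) ν →
        ∫ a, ∫ p, g p a ∂(ν.prod ν) ∂μ ≤ (1 / (m : ℝ)) * ∑ i, ∫ p, g p (y i) ∂(ν.prod ν) +
          (2 * ∫ z, llr ν ρ z ∂ν + Real.log (1 / δ)) / l + l * b ^ 2 / (2 * m) := by
  have hm0 : (0 : ℝ) < m := by exact_mod_cast hm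
  let D : (Z × Z) → (Fin m → α) → ℝ := fun p y =>
    ∫ a, g p a ∂μ - (1 / (m : ℝ)) * ∑ i, g p (y i)
  have hmean : Measurable fun p => ∫ a, g p a ∂μ :=
    (hg.stronglyMeasurable.integral_prod_right (ν := μ)).measurable
  have hD : Measurable (Function.uncurry D) := by
    refine (hmean.comp measurable_fst).sub (Measurable.const_mul ?_ _)
    refine Finset.measurable_fun_sum _ fun i _ => ?_
    exact hg.comp (measurable_fst.prodMk ((measurable_pi_apply i).comp measurable_snd))
  have hg1 : ∀ p, Measurable (g p) := fun p => hg.comp measurable_prodMk_left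
  have hg2 : ∀ a, Measurable fun p => g p a := fun a => hg.comp measurable_prodMk_right
  have hmeanb : ∀ p, |∫ a, g p a ∂μ| ≤ b := fun p => by
    simpa using norm_integral_le_of_norm_le_const (μ := μ) (f := g p) (ae_of_all _ (hb p))
  have hDb : ∀ p y, |D p y| ≤ 2 * b := fun p y => by
    have h2 : |(1 / (m : ℝ)) * ∑ i, g p (y i)| ≤ b := by
      rw [abs_mul, abs_of_pos (by positivity), one_div, inv_mul_le_iff₀ hm0]
      refine (Finset.abs_sum_le_sum_abs _ _).trans ?_
      simpa using Finset.sum_le_sum fun (i : Fin m) (_ : i ∈ Finset.univ) => hb p (y i)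
    calc |D p y| ≤ |∫ a, g p a ∂μ| + |(1 / (m : ℝ)) * ∑ i, g p (y i)| := abs_sub _ _
      _ ≤ 2 * b := by linarith [hmeanb p]
  have hexpm : Measurable fun q : (Z × Z) × (Fin m → α) => Real.exp (l * D q.1 q.2) :=
    (hD.const_mul l).exp
  have hexpb : ∀ p y, ‖Real.exp (l * D p y)‖ ≤ Real.exp (l * (2 * b)) := fun p y => by
    rw [Real.norm_eq_abs, Real.abs_exp]
    have := (le_abs_self _).trans (hDb p y)
    gcongr
  have hint : Integrable (fun q : (Z × Z) × (Fin m → α) => Real.exp (l * D q.1 q.2))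
      ((ρ.prod ρ).prod (Measure.pi fun _ => μ)) :=
    .of_bound hexpm.aestronglyMeasurable _ (ae_of_all _ fun q => hexpb q.1 q.2)
  let V : (Fin m → α) → ℝ := fun y => ∫ p, Real.exp (l * D p y) ∂(ρ.prod ρ)
  have hV : Measurable V :=
    (hexpm.stronglyMeasurable.integral_prod_left (μ := ρ.prod ρ)).measurable
  have hVint : Integrable V (Measure.pi fun _ => μ) := hint.integral_prod_right
  have hVpos : ∀ y, 0 < V y := fun y => by
    refine integral_exp_pos (.of_bound ?_ (Real.exp (l * (2 * b)))
      (ae_of_all _ fun p => hexpb p y))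
    exact (hexpm.comp measurable_prodMk_right).aestronglyMeasurable
  let B := Real.exp (l ^ 2 * b ^ 2 / (2 * m))
  have hB : 0 < B := Real.exp_pos _
  have hVle : ∫ y, V y ∂(Measure.pi fun _ => μ) ≤ B := by
    rw [integral_integral_swap (f := fun y p => Real.exp (l * D p y)) hint.swap]
    calc _ ≤ ∫ _, B ∂(ρ.prod ρ) :=
          integral_mono hint.integral_prod_left (integrable_const _) fun p =>
            integral_exp_mul_sub_average_le (hg1 p) (hb p) hm l
      _ = B := by simp
  refine ⟨{y | V y < B / δ}, measurableSet_lt hV measurable_const, ?_, ?_⟩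
  · have hmk := mul_meas_ge_le_integral_of_nonneg (ae_of_all _ fun y => (hVpos y).le) hVint (B / δ)
    have hset : {y | V y < B / δ}ᶜ = {y | B / δ ≤ V y} := by ext; simp
    rw [hset, ← ofReal_measureReal]
    refine ENNReal.ofReal_le_ofReal ?_
    have := hmk.trans hVle
    rw [div_mul_eq_mul_div, div_le_iff₀ hδ] at this
    exact le_of_mul_le_mul_left this hB
  · intro y hy ν hν hac hllr
    have hDy : Measurable fun p => l * D p y :=
      (hD.comp measurable_prodMk_right).const_mul l
    have hdv := integral_prod_le_integral_llr_add_log_integral_exp hac hllr hDy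
      (c := l * (2 * b)) fun p => by
        rw [abs_mul, abs_of_pos hl]
        exact mul_le_mul_of_nonneg_left (hDb p y) hl.le
    have hlog : Real.log (V y) ≤ l ^ 2 * b ^ 2 / (2 * m) + Real.log (1 / δ) := by
      calc Real.log (V y) ≤ Real.log (B * (1 / δ)) := by
            refine Real.log_le_log (hVpos y) ?_
            rw [mul_one_div]
            exact le_of_lt hy
        _ = _ := by rw [Real.log_mul hB.ne' (by positivity), Real.log_exp]
    have hgi : ∀ a, Integrable (fun p => g p a) (ν.prod ν) := fun a =>
      .of_bound (hg2 a).aestronglyMeasurable b (ae_of_all _ fun p => hb p a)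
    have hDint : ∫ p, l * D p y ∂(ν.prod ν) = l * (∫ a, ∫ p, g p a ∂(ν.prod ν) ∂μ -
        (1 / (m : ℝ)) * ∑ i, ∫ p, g p (y i) ∂(ν.prod ν)) := by
      rw [integral_const_mul, integral_sub, integral_const_mul, integral_finsetSum]
      · congr 2
        exact integral_integral_swap (.of_bound hg.aestronglyMeasurable b
          (ae_of_all _ fun q => hb q.1 q.2))
      · exact fun i _ => hgi _
      · exact .of_bound hmean.aestronglyMeasurable b (ae_of_all _ hmeanb)
      · exact (integrable_finsetSum _ fun i _ => hgi _).const_mul _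
    have hfin : l * (∫ a, ∫ p, g p a ∂(ν.prod ν) ∂μ -
        (1 / (m : ℝ)) * ∑ i, ∫ p, g p (y i) ∂(ν.prod ν)) ≤
        2 * ∫ z, llr ν ρ z ∂ν + (l ^ 2 * b ^ 2 / (2 * m) + Real.log (1 / δ)) := by
      rw [← hDint]
      exact hdv.trans (add_le_add_right hlog _)
    rw [← le_div_iff₀' hl] at hfin
    have : (2 * ∫ z, llr ν ρ z ∂ν + (l ^ 2 * b ^ 2 / (2 * m) + Real.log (1 / δ))) / l =
        (2 * ∫ z, llr ν ρ z ∂ν + Real.log (1 / δ)) / l + l * b ^ 2 / (2 * m) := by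
      field_simp
      ring
    linarith

lemma integrable_exp_neg_mul_norm_sq (d : ℕ) {c : ℝ} (hc : 0 < c) :
    Integrable fun x : Euc d => Real.exp (-(c * ‖x‖ ^ 2)) := by
  refine .of_integral_ne_zero ?_
  have h := GaussianFourier.integral_rexp_neg_mul_sq_norm (V := Euc d) hc
  simp only [neg_mul] at h
  rw [h]
  positivity

lemma gaussLike_eq_tilted (d : ℕ) (c : ℝ) :
    gaussLike d c = (volume : Measure (Euc d)).tilted fun x => -(c * ‖x‖ ^ 2) := rfl

lemma isProbabilityMeasure_gaussLike (d : ℕ) {c : ℝ} (hc : 0 < c) :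
    IsProbabilityMeasure (gaussLike d c) := by
  rw [gaussLike_eq_tilted]
  exact isProbabilityMeasure_tilted (integrable_exp_neg_mul_norm_sq d hc)

lemma integrable_llr_gaussLike_iff {d : ℕ} {c : ℝ} (hc : 0 < c) {ν : Measure (Euc d)}
    (hν : IsP2 ν) (hac : ν ≪ volume) :
    Integrable (llr ν (gaussLike d c)) ν ↔ Integrable (llr ν volume) ν := by
  have := hν.1
  rw [gaussLike_eq_tilted, integrable_congr
    (llr_tilted_right hac (integrable_exp_neg_mul_norm_sq d hc))]
  refine integrable_add_iff_integrable_right' ?_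
  exact (hν.2.const_mul c).neg.neg.add (integrable_const _)

lemma integral_llr_gaussLike {d : ℕ} {c : ℝ} (hc : 0 < c) {ν : Measure (Euc d)}
    (hν : IsP2 ν) (hac : ν ≪ volume) (hllr : Integrable (llr ν volume) ν) :
    ∫ x, llr ν (gaussLike d c) x ∂ν = ∫ x, llr ν volume x ∂ν + c * ∫ x, ‖x‖ ^ 2 ∂ν +
      Real.log (∫ y : Euc d, Real.exp (-(c * ‖y‖ ^ 2))) := by
  have := hν.1
  have hi : Integrable (fun x => -(c * ‖x‖ ^ 2)) ν := (hν.2.const_mul c).neg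
  rw [gaussLike_eq_tilted, integral_llr_tilted_right hac hi
    (integrable_exp_neg_mul_norm_sq d hc) hllr, integral_neg, integral_const_mul, sub_neg_eq_add]

lemma absolutelyContinuous_gaussLike {d : ℕ} {c : ℝ} (hc : 0 < c) :
    (volume : Measure (Euc d)) ≪ gaussLike d c :=
  absolutelyContinuous_tilted (integrable_exp_neg_mul_norm_sq d hc)

lemma gaussLike_absolutelyContinuous (d : ℕ) (c : ℝ) :
    gaussLike d c ≪ (volume : Measure (Euc d)) :=
  tilted_absolutelyContinuous _ _

lemma ent_eq_of_integrable_llr_gaussLike {d : ℕ} {c : ℝ} (hc : 0 < c) {ν : Measure (Euc d)}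
    (hν : IsP2 ν) (hac : ν ≪ gaussLike d c) (hllr : Integrable (llr ν (gaussLike d c)) ν) :
    Ent ν = ((∫ x, llr ν (gaussLike d c) x ∂ν - c * ∫ x, ‖x‖ ^ 2 ∂ν -
      Real.log (∫ y : Euc d, Real.exp (-(c * ‖y‖ ^ 2))) : ℝ) : EReal) := by
  have hac' := hac.trans (gaussLike_absolutelyContinuous d c)
  have hllr' := (integrable_llr_gaussLike_iff hc hν hac').1 hllr
  rw [integral_llr_gaussLike hc hν hac' hllr', Ent, if_pos ⟨hac', hllr'⟩]
  congr 1
  simp only [llr]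
  ring

lemma absolutelyContinuous_and_integrable_of_ent_ne_top {d : ℕ} {c : ℝ} (hc : 0 < c)
    {ν : Measure (Euc d)} (hν : IsP2 ν) (h : Ent ν ≠ ⊤) :
    ν ≪ gaussLike d c ∧ Integrable (llr ν (gaussLike d c)) ν := by
  have h' : ν ≪ volume ∧ Integrable (llr ν volume) ν := by
    by_contra hcon
    exact h (if_neg hcon)
  exact ⟨h'.1.trans (absolutelyContinuous_gaussLike hc),
    (integrable_llr_gaussLike_iff hc hν h'.1).2 h'.2⟩

lemma integral_llr_le_of_KL_le {α : Type*} [MeasurableSpace α] {ν ρ : Measure α} {M : ℝ}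
    (h : KL ν ρ ≤ (M : EReal)) :
    ν ≪ ρ ∧ Integrable (llr ν ρ) ν ∧ ∫ x, llr ν ρ x ∂ν ≤ M := by
  by_cases hcon : ν ≪ ρ ∧ Integrable (llr ν ρ) ν
  · refine ⟨hcon.1, hcon.2, ?_⟩
    have hkl : KL ν ρ = ((∫ x, llr ν ρ x ∂ν : ℝ) : EReal) := if_pos hcon
    rw [hkl] at h
    exact_mod_cast h
  · have hkl : KL ν ρ = ⊤ := if_neg hcon
    rw [hkl, top_le_iff] at h
    exact absurd h (EReal.coe_ne_top M)

lemma integral_llr_nonneg {α : Type*} [MeasurableSpace α] {ν ρ : Measure α}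
    [IsProbabilityMeasure ν] [IsProbabilityMeasure ρ] (hac : ν ≪ ρ)
    (hllr : Integrable (llr ν ρ) ν) : 0 ≤ ∫ x, llr ν ρ x ∂ν := by
  simpa using InformationTheory.integral_llr_add_sub_measure_univ_nonneg hac hllr

/-- Comparing the entropy-regularized objective of a finite-valued competitor with that of a
reference measure amounts to comparing the relative-entropy-regularized empirical losses. -/
lemma regularized_le_of_stage1Emp_le {da dw dx dz : ℕ} {Ω : Type} {ΨA : Euc da → Euc dx → ℝ}
    {ΨW : Euc dw → Euc dz → ℝ} {ζ1 σ1 : ℝ} (hζ : 0 < ζ1) (hσ : 0 < σ1) {m : ℕ}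
    {Av : Fin m → Ω → Euc da} {Wv : Fin m → Ω → Euc dw} {μx : Measure (Euc dx)} {ω : Ω}
    {ν ν' : Measure (Euc dz)} (hν : IsP2 ν) (hν' : IsP2 ν')
    (hac' : ν' ≪ gaussLike dz (ζ1 / (2 * σ1)))
    (hllr' : Integrable (llr ν' (gaussLike dz (ζ1 / (2 * σ1)))) ν')
    (hfin : stage1Emp ΨA ΨW ζ1 σ1 m Av Wv μx ω ν ≠ ⊤)
    (hle : stage1Emp ΨA ΨW ζ1 σ1 m Av Wv μx ω ν ≤ stage1Emp ΨA ΨW ζ1 σ1 m Av Wv μx ω ν') :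
    ν ≪ gaussLike dz (ζ1 / (2 * σ1)) ∧
    Integrable (llr ν (gaussLike dz (ζ1 / (2 * σ1)))) ν ∧
    (1 / (2 * (m : ℝ))) *
      ∑ i : Fin m, ((∫ z, ΨW (Wv i ω) z ∂ν) - (∫ x, ΨA (Av i ω) x ∂μx)) ^ 2 +
        σ1 * ∫ z, llr ν (gaussLike dz (ζ1 / (2 * σ1))) z ∂ν ≤
    (1 / (2 * (m : ℝ))) *
      ∑ i : Fin m, ((∫ z, ΨW (Wv i ω) z ∂ν') - (∫ x, ΨA (Av i ω) x ∂μx)) ^ 2 +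
        σ1 * ∫ z, llr ν' (gaussLike dz (ζ1 / (2 * σ1))) z ∂ν' := by
  have hc : 0 < ζ1 / (2 * σ1) := by positivity
  have hent : Ent ν ≠ ⊤ := by
    intro h
    apply hfin
    rw [stage1Emp, h, EReal.coe_mul_top_of_pos hσ, EReal.coe_add_top]
  obtain ⟨hac, hllr⟩ := absolutelyContinuous_and_integrable_of_ent_ne_top hc hν hent
  refine ⟨hac, hllr, ?_⟩
  rw [stage1Emp, stage1Emp, ent_eq_of_integrable_llr_gaussLike hc hν hac hllr,
    ent_eq_of_integrable_llr_gaussLike hc hν' hac' hllr'] at hle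
  rw [← EReal.coe_mul, ← EReal.coe_mul, ← EReal.coe_add, ← EReal.coe_add,
    EReal.coe_le_coe_iff] at hle
  have hcancel : ∀ x : ℝ, σ1 * (ζ1 / (2 * σ1) * x) = ζ1 / 2 * x := fun x => by
    field_simp
  simp only [mul_sub, hcancel] at hle
  linarith

/-- Excess squared risk of `F` over a version `f` of the conditional expectation of `h`. -/
lemma integral_half_sq_sub_half_sq {α β : Type*} [MeasurableSpace α] [MeasurableSpace β]
    {μ : Measure (α × β)} [IsProbabilityMeasure μ] {h : α → ℝ} {f F : β → ℝ}
    (hh : Measurable h) (hf : Measurable f) (hF : Measurable F) {R : ℝ}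
    (hhR : ∀ a, |h a| ≤ R) (hfR : ∀ w, |f w| ≤ R) (hFR : ∀ w, |F w| ≤ R)
    (horth : ∫ q, h q.1 * (F q.2 - f q.2) ∂μ = ∫ q, f q.2 * (F q.2 - f q.2) ∂μ) :
    ∫ q, (1 / 2 * (F q.2 - h q.1) ^ 2 - 1 / 2 * (f q.2 - h q.1) ^ 2) ∂μ =
      1 / 2 * ∫ q, (F q.2 - f q.2) ^ 2 ∂μ := by
  have hsub : ∀ w, |F w - f w| ≤ 2 * R := fun w => by
    linarith [abs_sub (F w) (f w), hFR w, hfR w]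
  have hm : ∀ {k : α × β → ℝ}, Measurable k → (∀ q, |k q| ≤ R) →
      Integrable (fun q => k q * (F q.2 - f q.2)) μ := fun {k} hk hkR => by
    refine .of_bound (Measurable.aestronglyMeasurable (by fun_prop)) (R * (2 * R))
      (ae_of_all _ fun q => ?_)
    rw [Real.norm_eq_abs, abs_mul]
    exact mul_le_mul (hkR q) (hsub _) (abs_nonneg _) ((abs_nonneg _).trans (hkR q))
  have h1 : Integrable (fun q => h q.1 * (F q.2 - f q.2)) μ :=
    hm (hh.comp measurable_fst) fun q => hhR _
  have h2 : Integrable (fun q => f q.2 * (F q.2 - f q.2)) μ :=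
    hm (hf.comp measurable_snd) fun q => hfR _
  have h3 : Integrable (fun q : α × β => (F q.2 - f q.2) ^ 2) μ := by
    have h4 : Integrable (fun q => F q.2 * (F q.2 - f q.2)) μ :=
      hm (hF.comp measurable_snd) fun q => hFR _
    refine (h4.sub h2).congr (ae_of_all _ fun q => ?_)
    simp only [Pi.sub_apply]
    ring
  calc _ = ∫ q, (1 / 2 * (F q.2 - f q.2) ^ 2 + (f q.2 * (F q.2 - f q.2) -
        h q.1 * (F q.2 - f q.2))) ∂μ := by
        congr 1 with q
        ring
    _ = _ := by
        have h5 : Integrable (fun q : α × β => f q.2 * (F q.2 - f q.2) -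
          h q.1 * (F q.2 - f q.2)) μ := h2.sub h1
        rw [integral_add (h3.const_mul _) h5, integral_sub h2 h1, horth, sub_self,
          add_zero, integral_const_mul]

lemma abs_integral_le_of_abs_le {Z : Type*} [MeasurableSpace Z] {ν : Measure Z}
    [IsProbabilityMeasure ν] {f : Z → ℝ} {R : ℝ} (hf : ∀ z, |f z| ≤ R) :
    |∫ z, f z ∂ν| ≤ R := by
  simpa using norm_integral_le_of_norm_le_const (μ := ν) (f := f) (ae_of_all _ hf)

lemma integral_prod_half_mul_sub {Z : Type*} [MeasurableSpace Z] {ν : Measure Z}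
    [IsProbabilityMeasure ν] {f : Z → ℝ} (hf : Integrable f ν) (y k : ℝ) :
    ∫ p, (1 / 2 * ((f p.1 - y) * (f p.2 - y)) - k) ∂(ν.prod ν) =
      1 / 2 * (∫ z, f z ∂ν - y) ^ 2 - k := by
  have hi : Integrable (fun z => f z - y) ν := hf.sub (integrable_const y)
  rw [integral_sub ((hi.mul_prod hi).const_mul _) (integrable_const k), integral_const_mul,
    integral_prod_mul (fun z => f z - y) (fun z => f z - y), integral_sub hf (integrable_const y)]
  simp only [integral_const, probReal_univ, one_smul]
  ring

/-- The PAC-Bayes penalty at the inverse temperature that balances its two terms. -/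
lemma tuned_pacBayes_le {R σ M m L κ : ℝ} (hR : 0 < R) (hσ : 0 < σ) (hM : 0 < M) (hm : 0 < m)
    (hL : 0 < L) (hκ : κ ≤ M + 2 * R ^ 2 / σ) :
    (2 * κ + L) / (√((2 * (M + 2 * R ^ 2 / σ) + L) * m) / R ^ 2) +
      √((2 * (M + 2 * R ^ 2 / σ) + L) * m) / R ^ 2 * (4 * R ^ 2) ^ 2 / (2 * m) ≤
      9 * (R ^ 2 * √(L / m)) + 18 * (R ^ 2 * √((M + R ^ 2 / σ) / m)) := by
  set K := 2 * (M + 2 * R ^ 2 / σ) + L with hK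
  have hKpos : 0 < K := by positivity
  have hs : 0 < √(K * m) := by positivity
  have hsq : √(K * m) * √(K * m) = K * m := Real.mul_self_sqrt (by positivity)
  have hKm : √(K / m) = √(K * m) / m := by
    rw [← mul_div_mul_right K m hm.ne', Real.sqrt_div (by positivity), Real.sqrt_mul_self hm.le]
  have h1 : (2 * κ + L) / (√(K * m) / R ^ 2) ≤ R ^ 2 * √(K / m) := by
    rw [hKm, div_le_iff₀ (by positivity)]
    have : R ^ 2 * (√(K * m) / m) * (√(K * m) / R ^ 2) = K := by
      field_simp
      linarith
    rw [this]
    linarith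
  have h2 : √(K * m) / R ^ 2 * (4 * R ^ 2) ^ 2 / (2 * m) = 8 * (R ^ 2 * √(K / m)) := by
    rw [hKm]
    field_simp
    ring
  have h3 : √(K / m) ≤ √(L / m) + 2 * √((M + R ^ 2 / σ) / m) := by
    refine Real.sqrt_le_iff.2 ⟨by positivity, ?_⟩
    have h4 := Real.sq_sqrt (by positivity : 0 ≤ L / m)
    have h5 := Real.sq_sqrt (by positivity : 0 ≤ (M + R ^ 2 / σ) / m)
    have h6 : 0 ≤ √(L / m) * √((M + R ^ 2 / σ) / m) := by positivity
    have h7 : K / m ≤ L / m + 4 * ((M + R ^ 2 / σ) / m) := by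
      rw [← mul_div_assoc, ← add_div]
      gcongr
      rw [hK, mul_div_assoc]
      linarith
    nlinarith
  have h8 := mul_le_mul_of_nonneg_left h3 (sq_nonneg R)
  linarith

/-- Proposition 7.1, Stage-I generalization bound: there is an absolute
constant `C > 0` such that, with probability at least `1 − 2δ`, the Stage-I projected error of
the empirical minimizer is at most
`C(σ₁M_z + R²√(log(1/δ)/m) + R²√((M_z + R²/σ₁)/m))`. -/
theorem stmt4 :
    ∃ C : ℝ, 0 < C ∧
    ∀ (da dw dx dz : ℕ), 0 < da → 0 < dw → 0 < dx → 0 < dz →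
    ∀ (R ζ1 σ1 : ℝ), 0 < R → 0 < ζ1 → 0 < σ1 →
    ∀ (P : Measure (Euc da × Euc dw × ℝ)), IsProbabilityMeasure P →
    ∀ (ΨA : Euc da → Euc dx → ℝ) (ΨW : Euc dw → Euc dz → ℝ),
      Measurable (Function.uncurry ΨA) → Measurable (Function.uncurry ΨW) →
      (∀ a x, |ΨA a x| ≤ R) → (∀ w z, |ΨW w z| ≤ R) →
    ∀ (μx : Measure (Euc dx)), IsP2 μx →
    ∀ (Mz : ℝ), 0 < Mz →
    -- Stage-I well-specifiedness at `μ_x`, witnessed by `μ_z°`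
    ∀ (μz0 : Measure (Euc dz)), IsP2 μz0 →
      KL μz0 (gaussLike dz (ζ1 / (2 * σ1))) ≤ ((Mz : ℝ) : EReal) →
      (∀ u : Euc dw → ℝ, Measurable u → (∃ c : ℝ, ∀ w, |u w| ≤ c) →
        ∫ q, (∫ x, ΨA q.1 x ∂μx) * u q.2 ∂(P.map fun p => (p.1, p.2.1)) =
          ∫ w, (∫ z, ΨW w z ∂μz0) * u w ∂(P.map fun p => p.2.1)) →
    ∀ (δ : ℝ), δ ∈ Set.Ioo (0 : ℝ) (1 / 2) →
    ∀ (m : ℕ), 1 ≤ m →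
    ∀ (Ω : Type) (_ : MeasurableSpace Ω) (Q : Measure Ω), IsProbabilityMeasure Q →
    ∀ (Av : Fin m → Ω → Euc da) (Wv : Fin m → Ω → Euc dw),
      -- `(Aᵢ, Wᵢ)` i.i.d. with law `P_{AW}`
      Measure.map (fun ω => fun i => (Av i ω, Wv i ω)) Q =
        (Measure.pi fun _ : Fin m => P.map fun p => (p.1, p.2.1)) →
    ∀ (μhz : Ω → Measure (Euc dz)),
      -- `μ̂_z` a.s. minimizes the empirical Stage-I objective over `P₂`, with finite value
      (∀ᵐ ω ∂Q, IsP2 (μhz ω) ∧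
        stage1Emp ΨA ΨW ζ1 σ1 m Av Wv μx ω (μhz ω) ≠ ⊤ ∧
        stage1Emp ΨA ΨW ζ1 σ1 m Av Wv μx ω (μhz ω) ≠ ⊥ ∧
        ∀ ν, IsP2 ν →
          stage1Emp ΨA ΨW ζ1 σ1 m Av Wv μx ω (μhz ω) ≤
            stage1Emp ΨA ΨW ζ1 σ1 m Av Wv μx ω ν) →
      Measurable (fun ω =>
        ∫ w, ((∫ z, ΨW w z ∂(μhz ω)) - (∫ z, ΨW w z ∂μz0)) ^ 2
          ∂(P.map fun p => p.2.1)) →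
    Q {ω | ∫ w, ((∫ z, ΨW w z ∂(μhz ω)) - (∫ z, ΨW w z ∂μz0)) ^ 2
            ∂(P.map fun p => p.2.1) ≤
          C * (σ1 * Mz + R ^ 2 * Real.sqrt (Real.log (1 / δ) / m) +
            R ^ 2 * Real.sqrt ((Mz + R ^ 2 / σ1) / m))} ≥
      ENNReal.ofReal (1 - 2 * δ) := by
  refine ⟨36, by norm_num, ?_⟩
  intro da dw dx dz _ _ _ _ R ζ1 σ1 hR hζ hσ P hP ΨA ΨW hΨA hΨW hAR hWR μx hμx Mz hMz μz0 hμz0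
    hKL hwell δ hδ m hm Ω _ Q hQ Av Wv hiid μhz hmin _
  have := hμx.1
  have := hμz0.1
  have hm0 : (0 : ℝ) < m := by exact_mod_cast hm
  have hc : 0 < ζ1 / (2 * σ1) := by positivity
  have := isProbabilityMeasure_gaussLike dz hc
  set γ := gaussLike dz (ζ1 / (2 * σ1)) with hγ
  obtain ⟨hac0, hllr0, hKL0⟩ := integral_llr_le_of_KL_le hKL
  set μ : Measure (Euc da × Euc dw) := P.map fun p => (p.1, p.2.1) with hμ
  have hμprob : IsProbabilityMeasure μ := Measure.isProbabilityMeasure_map (by fun_prop)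
  have hPw : (P.map fun p => p.2.1) = μ.map Prod.snd := by
    rw [hμ, Measure.map_map (by fun_prop) (by fun_prop)]
    rfl
  rw [hPw] at hwell ⊢
  let h : Euc da → ℝ := fun a => ∫ x, ΨA a x ∂μx
  let F : Measure (Euc dz) → Euc dw → ℝ := fun ν w => ∫ z, ΨW w z ∂ν
  have hh : Measurable h := (hΨA.stronglyMeasurable.integral_prod_right (ν := μx)).measurable
  have hF : ∀ ν, IsProbabilityMeasure ν → Measurable (F ν) := fun ν _ =>
    (hΨW.stronglyMeasurable.integral_prod_right (ν := ν)).measurable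
  have hhR : ∀ a, |h a| ≤ R := fun a => abs_integral_le_of_abs_le (hAR a)
  have hFR : ∀ ν, IsProbabilityMeasure ν → ∀ w, |F ν w| ≤ R := fun ν _ w =>
    abs_integral_le_of_abs_le (hWR w)
  have hrisk : ∀ ν, IsProbabilityMeasure ν →
      ∫ q, (1 / 2 * (F ν q.2 - h q.1) ^ 2 - 1 / 2 * (F μz0 q.2 - h q.1) ^ 2) ∂μ =
        1 / 2 * ∫ w, (F ν w - F μz0 w) ^ 2 ∂(μ.map Prod.snd) := fun ν hν => by
    have hmeas : Measurable fun w => F ν w - F μz0 w := (hF ν hν).sub (hF μz0 hμz0.1)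
    rw [integral_map measurable_snd.aemeasurable (hmeas.pow_const 2).aestronglyMeasurable]
    refine integral_half_sq_sub_half_sq hh (hF μz0 hμz0.1) (hF ν hν) hhR (hFR _ hμz0.1)
      (hFR ν hν) ?_
    have hw := hwell (fun w => F ν w - F μz0 w) hmeas ⟨2 * R, fun w => by
      linarith [abs_sub (F ν w) (F μz0 w), hFR ν hν w, hFR μz0 hμz0.1 w]⟩
    have hmul : Measurable fun w => F μz0 w * (F ν w - F μz0 w) := (hF μz0 hμz0.1).mul hmeas
    exact hw.trans (integral_map measurable_snd.aemeasurable hmul.aestronglyMeasurable)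
  let g : Euc dz × Euc dz → Euc da × Euc dw → ℝ := fun p q =>
    1 / 2 * ((ΨW q.2 p.1 - h q.1) * (ΨW q.2 p.2 - h q.1)) - 1 / 2 * (F μz0 q.2 - h q.1) ^ 2
  have hg : Measurable (Function.uncurry g) := by
    have h1 : Measurable fun r : (Euc dz × Euc dz) × (Euc da × Euc dw) => ΨW r.2.2 r.1.1 :=
      hΨW.comp (by fun_prop : Measurable fun r : (Euc dz × Euc dz) × (Euc da × Euc dw) =>
        (r.2.2, r.1.1))
    have h2 : Measurable fun r : (Euc dz × Euc dz) × (Euc da × Euc dw) => ΨW r.2.2 r.1.2 :=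
      hΨW.comp (by fun_prop : Measurable fun r : (Euc dz × Euc dz) × (Euc da × Euc dw) =>
        (r.2.2, r.1.2))
    have h3 := hF μz0 hμz0.1
    exact (((h1.sub (by fun_prop)).mul (h2.sub (by fun_prop))).const_mul _).sub
      (((by fun_prop : Measurable fun r : (Euc dz × Euc dz) × (Euc da × Euc dw) =>
        F μz0 r.2.2 - h r.2.1).pow_const 2).const_mul _)
  have hdiff : ∀ {x y : ℝ}, |x| ≤ R → |y| ≤ R → |x - y| ≤ 2 * R := fun {x y} hx hy => by
    linarith [abs_sub x y]
  have hgb : ∀ p q, |g p q| ≤ 4 * R ^ 2 := fun p q => by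
    have h1 := mul_le_mul (hdiff (hWR q.2 p.1) (hhR q.1)) (hdiff (hWR q.2 p.2) (hhR q.1))
      (abs_nonneg _) (by positivity)
    have h2 := mul_le_mul (hdiff (hFR μz0 hμz0.1 q.2) (hhR q.1))
      (hdiff (hFR μz0 hμz0.1 q.2) (hhR q.1)) (abs_nonneg _) (by positivity)
    rw [← abs_mul] at h1 h2
    rw [abs_le] at h1 h2 ⊢
    constructor <;> dsimp only [g] <;> nlinarith
  have hgint : ∀ ν, IsProbabilityMeasure ν → ∀ q, ∫ p, g p q ∂(ν.prod ν) =
      1 / 2 * (F ν q.2 - h q.1) ^ 2 - 1 / 2 * (F μz0 q.2 - h q.1) ^ 2 := fun ν _ q =>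
    integral_prod_half_mul_sub (.of_bound (hΨW.comp measurable_prodMk_left).aestronglyMeasurable R
      (ae_of_all _ (hWR q.2))) _ _
  have hL : 0 < Real.log (1 / δ) := Real.log_pos (by
    rw [lt_div_iff₀ hδ.1]
    linarith [hδ.2])
  let K := 2 * (Mz + 2 * R ^ 2 / σ1) + Real.log (1 / δ)
  have hK : 0 < K := by positivity
  let l := √(K * m) / R ^ 2
  have hl : 0 < l := by positivity
  obtain ⟨S, hS, hSδ, hpac⟩ := exists_measurableSet_pacBayes (μ := μ) (ρ := γ) hg hgb hm hl hδ.1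
  set T : Ω → Fin m → Euc da × Euc dw := fun ω i => (Av i ω, Wv i ω) with hT
  have hTm : AEMeasurable T Q := by
    refine AEMeasurable.of_map_ne_zero ?_
    rw [hiid]
    exact IsProbabilityMeasure.ne_zero _
  have hQS : ENNReal.ofReal (1 - 2 * δ) ≤ Q (T ⁻¹' S) := by
    rw [← Measure.map_apply_of_aemeasurable hTm hS, hiid]
    rw [prob_compl_eq_one_sub hS] at hSδ
    rw [ENNReal.ofReal_sub _ (by linarith [hδ.1]), ENNReal.ofReal_one]
    have h1 : (1 : ℝ≥0∞) ≤ ENNReal.ofReal (2 * δ) + (Measure.pi fun _ => μ) S :=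
      (tsub_le_iff_right.1 hSδ).trans
        (add_le_add_left (ENNReal.ofReal_le_ofReal (by linarith [hδ.1])) _)
    exact tsub_le_iff_left.2 h1
  refine hQS.trans (measure_mono_ae ?_)
  filter_upwards [hmin] with ω hω hωS
  obtain ⟨hP2, htop, -, hopt⟩ := hω
  have hprob := hP2.1
  obtain ⟨hac, hllr, hreg⟩ :=
    regularized_le_of_stage1Emp_le hζ hσ hP2 hμz0 hac0 hllr0 htop (hopt μz0 hμz0)
  rw [← hγ] at hac hllr hreg
  change (1 / (2 * (m : ℝ))) * ∑ i, (F (μhz ω) (Wv i ω) - h (Av i ω)) ^ 2 + σ1 * _ ≤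
    (1 / (2 * (m : ℝ))) * ∑ i, (F μz0 (Wv i ω) - h (Av i ω)) ^ 2 + σ1 * _ at hreg
  have hkl := integral_llr_nonneg hac hllr
  have hb := hpac (T ω) hωS (μhz ω) hprob hac hllr
  simp_rw [hgint (μhz ω) hprob] at hb
  rw [hrisk (μhz ω) hprob] at hb
  have hsplit : (1 / (m : ℝ)) * ∑ i, (1 / 2 * (F (μhz ω) (T ω i).2 - h (T ω i).1) ^ 2 -
        1 / 2 * (F μz0 (T ω i).2 - h (T ω i).1) ^ 2) =
      (1 / (2 * (m : ℝ))) * ∑ i, (F (μhz ω) (Wv i ω) - h (Av i ω)) ^ 2 -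
        (1 / (2 * (m : ℝ))) * ∑ i, (F μz0 (Wv i ω) - h (Av i ω)) ^ 2 := by
    rw [Finset.sum_sub_distrib, ← Finset.mul_sum, ← Finset.mul_sum]
    field_simp
    rfl
  have hloss0 : (1 / (2 * (m : ℝ))) * ∑ i, (F μz0 (Wv i ω) - h (Av i ω)) ^ 2 ≤ 2 * R ^ 2 := by
    have h1 : ∑ i, (F μz0 (Wv i ω) - h (Av i ω)) ^ 2 ≤ ∑ _i : Fin m, (2 * R) ^ 2 :=
      Finset.sum_le_sum fun i _ => sq_le_sq' (abs_le.1 (hdiff (hFR _ hμz0.1 _) (hhR _))).1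
        (abs_le.1 (hdiff (hFR _ hμz0.1 _) (hhR _))).2
    rw [Finset.sum_const, Finset.card_univ, Fintype.card_fin, nsmul_eq_mul] at h1
    rw [one_div, inv_mul_le_iff₀ (by positivity)]
    linarith
  have hloss : 0 ≤ (1 / (2 * (m : ℝ))) * ∑ i, (F (μhz ω) (Wv i ω) - h (Av i ω)) ^ 2 := by
    positivity
  have hreg0 : σ1 * ∫ z, llr μz0 γ z ∂μz0 ≤ σ1 * Mz := mul_le_mul_of_nonneg_left hKL0 hσ.le
  have hklle : ∫ z, llr (μhz ω) γ z ∂(μhz ω) ≤ Mz + 2 * R ^ 2 / σ1 := by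
    rw [← mul_le_mul_iff_right₀ hσ, mul_add, mul_div_cancel₀ _ hσ.ne']
    linarith
  have hklσ := mul_nonneg hσ.le hkl
  have htune : (2 * ∫ z, llr (μhz ω) γ z ∂(μhz ω) + Real.log (1 / δ)) / l +
      l * (4 * R ^ 2) ^ 2 / (2 * m) ≤ _ := tuned_pacBayes_le hR hσ hMz hm0 hL hklle
  change ∫ w, (F (μhz ω) w - F μz0 w) ^ 2 ∂(μ.map Prod.snd) ≤ _
  rw [hsplit] at hb
  have hσM : 0 < σ1 * Mz := by positivity
  have hsq1 : 0 ≤ R ^ 2 * √(Real.log (1 / δ) / m) := by positivity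
  have hsq2 : 0 ≤ R ^ 2 * √((Mz + R ^ 2 / σ1) / m) := by positivity
  linarith
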